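/- Let R be an integral domain containing ℚ and (H,∇)/R[[t₁,…,t_d]] a finite-rank F-bundle with fiber H₀ = H/(t,u)H. Suppose v ∈ H₀ satisfies the injectivity condition (IC) (the evaluation map μ_v : ⊕ᵢ R∂_{t_i} → H₀, ∂_{t_i} ↦ [u∇_{∂_{t_i}}]|_{t=u=0}(v), is injective), the generation condition (GC) (the orbit of v under R[im μ, K] equals H₀, where K is the residue of u²∇_{∂_u}), and coker μ_v is a free R-module. Then there exists a maximal unfolding of (H,∇) with cyclic vector induced from v, i.e., an unfolding over R[[t₁,…,t_d,s₁,…,s_ℓ]] (ℓ = rank − d) whose evaluation map μ_v is an isomorphism. -/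

import Mathlib

/-!
Formal Hertling–Manin unfolding theorem for F-bundles, existence part.  An F-bundle of
rank `N` over `R[[t₁,…,t_d]]` is presented in a trivialization by its connection matrices:
`∇_{∂_{t_i}} = ∂_{t_i} + u⁻¹A_i` and `∇_{∂_u} = ∂_u + u⁻²B`, with `A_i, B` matrices over
`R[[t₁,…,t_d,u]]` (`u` the last of the `d+1` formal variables) and the flatness equations
(cleared of denominators).  An unfolding over `R[[t₁,…,t_d,s₁,…,s_ℓ]]` is an F-bundle
over the larger base together with a gauge transformation identifying its restriction to
`s = 0` with the original one, compatibly with the connections.  Residues at `t = u = 0`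
give the maps `μ, K`; for `v` in the fiber `R^N`, the evaluation matrix has columns
`(residue of A_j)·v`.  If `v` satisfies (IC) (the evaluation map is injective), (GC) (the
orbit of `v` under the subalgebra `R[im μ, K]` is the whole fiber) and `coker μ_v` is
free, then there is a maximal unfolding in `ℓ = N − d` extra variables whose evaluation
map at (the vector induced from) `v` is bijective.
-/

noncomputable section

open MvPowerSeries

/-- The formal partial derivative of a multivariate formal power series in the `i`-th
variable, defined coefficientwise. -/
def fpderiv {m : ℕ} {A : Type*} [Ring A] (i : Fin m) (f : MvPowerSeries (Fin m) A) :
    MvPowerSeries (Fin m) A :=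
  fun k => ((k i : ℕ) + 1) • f (k + Finsupp.single i 1)

/-- An F-bundle of rank `N` over `R[[t₁,…,t_d]]`, presented in a trivialization:
connection matrices `A i` for `∇_{∂_{t_i}} = ∂_{t_i} + u⁻¹ A_i` and `B` for
`∇_{∂_u} = ∂_u + u⁻² B`, over `R[[t₁,…,t_d,u]]` with `u` the last variable, together
with the flatness equations (multiplied through by powers of `u`). -/
structure FBundle (R : Type*) [CommRing R] (d N : ℕ) where
  A : Fin d → Matrix (Fin N) (Fin N) (MvPowerSeries (Fin (d + 1)) R)
  B : Matrix (Fin N) (Fin N) (MvPowerSeries (Fin (d + 1)) R)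
  flat_tt : ∀ i j, (X (Fin.last d) : MvPowerSeries (Fin (d + 1)) R) •
      ((A j).map (fpderiv i.castSucc) - (A i).map (fpderiv j.castSucc))
      + (A i * A j - A j * A i) = 0
  flat_tu : ∀ i, (X (Fin.last d) ^ 2 : MvPowerSeries (Fin (d + 1)) R) •
      ((A i).map (fpderiv (Fin.last d))) + (B * A i - A i * B)
      = (X (Fin.last d) : MvPowerSeries (Fin (d + 1)) R) •
        (A i + B.map (fpderiv i.castSucc))

/-- The inclusion of variables `t₁,…,t_d,u` into `t₁,…,t_d,s₁,…,s_ℓ,u`. -/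
def varEmb (d ℓ : ℕ) : Fin (d + 1) → Fin (d + ℓ + 1) := fun i =>
  if h : (i : ℕ) < d then ⟨i, by omega⟩ else Fin.last _

/-- Restriction of a power series in `t₁,…,t_d,s₁,…,s_ℓ,u` to `s = 0`, as a power series
in `t₁,…,t_d,u`. -/
def resVar {R : Type*} [CommRing R] {d ℓ : ℕ}
    (f : MvPowerSeries (Fin (d + ℓ + 1)) R) : MvPowerSeries (Fin (d + 1)) R :=
  fun k => f (Finsupp.mapDomain (varEmb d ℓ) k)

/-- `F'` is an unfolding of `F` via the gauge transformation `P`: `P` is invertible and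
intertwines the connection of `F` with the restriction to `s = 0` of the connection of
`F'` (in the `t`- and `u`-directions). -/
def UnfoldsVia {R : Type*} [CommRing R] {d ℓ N : ℕ} (F : FBundle R d N)
    (F' : FBundle R (d + ℓ) N)
    (P : Matrix (Fin N) (Fin N) (MvPowerSeries (Fin (d + 1)) R)) : Prop :=
  IsUnit P ∧
  (∀ j : Fin d, (X (Fin.last d) : MvPowerSeries (Fin (d + 1)) R) •
      (P.map (fpderiv j.castSucc))
      + ((F'.A (Fin.castAdd ℓ j)).map (resVar (R := R))) * P = P * F.A j) ∧
  ((X (Fin.last d) ^ 2 : MvPowerSeries (Fin (d + 1)) R) •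
      (P.map (fpderiv (Fin.last d)))
      + (F'.B.map (resVar (R := R))) * P = P * F.B)

/-- The residue of the connection matrix `A j` at `t = u = 0`. -/
def resid {R : Type*} [CommRing R] {d N : ℕ} (F : FBundle R d N) (j : Fin d) :
    Matrix (Fin N) (Fin N) R :=
  (F.A j).map fun f => f (0 : Fin (d + 1) →₀ ℕ)

/-- The residue `K` of `u²∇_{∂_u}` at `t = u = 0`. -/
def residB {R : Type*} [CommRing R] {d N : ℕ} (F : FBundle R d N) :
    Matrix (Fin N) (Fin N) R :=
  F.B.map fun f => f (0 : Fin (d + 1) →₀ ℕ)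

/-- The matrix of the evaluation map `μ_v`: its `j`-th column is `(resid F j)·v`. -/
def evalMat {R : Type*} [CommRing R] {d N : ℕ} (F : FBundle R d N)
    (v : Fin N → R) : Matrix (Fin N) (Fin d) R :=
  Matrix.of fun p j => (resid F j).mulVec v p


section helpers

variable {R : Type*} [CommRing R]

lemma fpd_eq {m : ℕ} (i : Fin m) (f : MvPowerSeries (Fin m) R) :
    fpderiv i f = MvPowerSeries.pderiv R i f := by
  ext k
  rw [MvPowerSeries.coeff_pderiv]
  show ((k i : ℕ) + 1) • f (k + Finsupp.single i 1) = f (k + Finsupp.single i 1) * _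
  rw [nsmul_eq_mul, mul_comm]; push_cast; rfl

lemma fpd_comm {m : ℕ} (i j : Fin m) (f : MvPowerSeries (Fin m) R) :
    fpderiv i (fpderiv j f) = fpderiv j (fpderiv i f) := by
  by_cases h : i = j
  · rw [h]
  ext k
  show ((k i : ℕ) + 1) • (((k + Finsupp.single i 1 : Fin m →₀ ℕ) j + 1) •
      f (k + Finsupp.single i 1 + Finsupp.single j 1)) =
    ((k j : ℕ) + 1) • (((k + Finsupp.single j 1 : Fin m →₀ ℕ) i + 1) •
      f (k + Finsupp.single j 1 + Finsupp.single i 1))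
  have h' : j ≠ i := fun e => h e.symm
  rw [add_right_comm k, smul_smul, smul_smul]
  simp [h, h', mul_comm]

lemma X_mul_apply {m : ℕ} (u : Fin m) (f : MvPowerSeries (Fin m) R) (k : Fin m →₀ ℕ) :
    (X u * f : MvPowerSeries (Fin m) R) (k + Finsupp.single u 1) = f k := by
  have := MvPowerSeries.coeff_add_monomial_mul (Finsupp.single u 1) k f (1 : R)
  rw [one_mul, add_comm] at this
  exact this

/-- Restriction to `u = 0`, as a power series in the same variables. -/
def ev0 {m : ℕ} (u : Fin m) : MvPowerSeries (Fin m) R →ₐ[R] MvPowerSeries (Fin m) R where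
  toFun f := fun k => if k u = 0 then f k else 0
  map_one' := by
    classical
    ext k
    show (if k u = 0 then (coeff k (1 : MvPowerSeries (Fin m) R)) else 0) = _
    rw [coeff_one]
    split_ifs with h1 h2 h2 <;> simp_all
  map_zero' := by
    ext k
    show (if k u = 0 then (0 : R) else 0) = 0
    simp
  map_add' f g := by
    ext k
    show (if k u = 0 then f k + g k else 0) = (if k u = 0 then f k else 0) + (if k u = 0 then g k else 0)
    split_ifs <;> simp
  map_mul' f g := by
    classical
    ext k
    refine Eq.trans ?_ (coeff_mul _ _ _).symm
    show (if k u = 0 then coeff k (f * g) else 0) =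
      ∑ p ∈ Finset.HasAntidiagonal.antidiagonal k, (if p.1 u = 0 then f p.1 else 0) * (if p.2 u = 0 then g p.2 else 0)
    rw [coeff_mul]
    split_ifs with h
    · refine Finset.sum_congr rfl fun p hp => ?_
      have := Finset.HasAntidiagonal.mem_antidiagonal.1 hp
      rw [← this, Finsupp.add_apply] at h
      rw [if_pos (by omega), if_pos (by omega)]; rfl
    · symm
      refine Finset.sum_eq_zero fun p hp => ?_
      have := Finset.HasAntidiagonal.mem_antidiagonal.1 hp
      rw [← this, Finsupp.add_apply] at h
      by_cases h1 : p.1 u = 0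
      · rw [if_neg (show ¬ p.2 u = 0 by omega), mul_zero]
      · rw [if_neg h1, zero_mul]
  commutes' r := by
    classical
    ext k
    rw [MvPowerSeries.algebraMap_apply]
    show (if k u = 0 then (coeff k (C (algebraMap R R r) : MvPowerSeries (Fin m) R)) else 0) = _
    rw [coeff_C]
    split_ifs with h1 h2 h2 <;> simp_all

lemma ev0_apply {m : ℕ} (u : Fin m) (f : MvPowerSeries (Fin m) R) (k : Fin m →₀ ℕ) :
    ev0 u f k = if k u = 0 then f k else 0 := rfl

/-- Division by `u` after removing the `u`-constant part. -/
def shf {m : ℕ} (u : Fin m) (f : MvPowerSeries (Fin m) R) : MvPowerSeries (Fin m) R :=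
  fun k => f (k + Finsupp.single u 1)

lemma X_mul_shf {m : ℕ} (u : Fin m) (f : MvPowerSeries (Fin m) R) :
    X u * shf u f = f - ev0 u f := by
  classical
  ext k
  show (X u * shf u f : MvPowerSeries (Fin m) R) k = f k - ev0 u f k
  rw [ev0_apply]
  by_cases h : k u = 0
  · rw [if_pos h, sub_self]
    show coeff k (X u * shf u f) = 0
    rw [X, coeff_monomial_mul, if_neg]
    intro h'
    have := h' u
    simp [h] at this
  · rw [if_neg h, sub_zero]
    obtain ⟨k', rfl⟩ : ∃ k', k = k' + Finsupp.single u 1 := by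
      refine ⟨k - Finsupp.single u 1, (tsub_add_cancel_of_le ?_).symm⟩
      rw [Finsupp.single_le_iff]; omega
    rw [X_mul_apply]; rfl

lemma fpd_ev0 {m : ℕ} (u : Fin m) (f : MvPowerSeries (Fin m) R) :
    fpderiv u (ev0 u f) = 0 := by
  ext k
  show ((k u : ℕ) + 1) • (ev0 u f (k + Finsupp.single u 1)) = 0
  rw [ev0_apply, if_neg (by simp), smul_zero]

lemma varEmb_inj (d ℓ : ℕ) : Function.Injective (varEmb d ℓ) := by
  intro a b h
  unfold varEmb at h
  split_ifs at h with h1 h2 h2 <;> simp [Fin.ext_iff] at h ⊢ <;> omega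

lemma md_inj (d ℓ : ℕ) : Function.Injective
    (Finsupp.mapDomain (varEmb d ℓ) : (Fin (d + 1) →₀ ℕ) → _) :=
  Finsupp.mapDomain_injective (varEmb_inj d ℓ)

lemma resVar_mul {d ℓ : ℕ} (f g : MvPowerSeries (Fin (d + ℓ + 1)) R) :
    resVar (f * g) = resVar f * resVar g := by
  classical
  ext k
  rw [coeff_mul]
  show coeff (Finsupp.mapDomain (varEmb d ℓ) k) (f * g) = ∑ p ∈ Finset.HasAntidiagonal.antidiagonal k,
    f (Finsupp.mapDomain (varEmb d ℓ) p.1) * g (Finsupp.mapDomain (varEmb d ℓ) p.2)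
  rw [coeff_mul]
  symm
  refine Finset.sum_bij (fun p _ => (Finsupp.mapDomain (varEmb d ℓ) p.1,
    Finsupp.mapDomain (varEmb d ℓ) p.2)) ?_ ?_ ?_ ?_
  · intro p hp
    rw [Finset.HasAntidiagonal.mem_antidiagonal] at hp ⊢
    rw [← hp, Finsupp.mapDomain_add]
  · intro p _ q _ h
    rw [Prod.mk.injEq] at h
    exact Prod.ext (md_inj _ _ h.1) (md_inj _ _ h.2)
  · rintro ⟨a, b⟩ hp
    rw [Finset.HasAntidiagonal.mem_antidiagonal] at hp
    have key : ∀ x, x ∉ Set.range (varEmb d ℓ) → a x = 0 ∧ b x = 0 := by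
      intro x hx
      have h1 : (a + b) x = 0 := by
        have : a + b = Finsupp.mapDomain (varEmb d ℓ) k := hp
        rw [this]; exact Finsupp.mapDomain_of_notMem_range k x hx
      rw [Finsupp.add_apply] at h1
      omega
    have ha : (a.support : Set _) ⊆ Set.range (varEmb d ℓ) := by
      intro x hx
      by_contra h
      exact (Finsupp.mem_support_iff.1 hx) (key x h).1
    have hb : (b.support : Set _) ⊆ Set.range (varEmb d ℓ) := by
      intro x hx
      by_contra h
      exact (Finsupp.mem_support_iff.1 hx) (key x h).2
    have ea := Finsupp.mapDomain_comapDomain (varEmb d ℓ) (varEmb_inj d ℓ) a ha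
    have eb := Finsupp.mapDomain_comapDomain (varEmb d ℓ) (varEmb_inj d ℓ) b hb
    refine ⟨(Finsupp.comapDomain (varEmb d ℓ) a (varEmb_inj d ℓ).injOn,
      Finsupp.comapDomain (varEmb d ℓ) b (varEmb_inj d ℓ).injOn), ?_, ?_⟩
    · rw [Finset.HasAntidiagonal.mem_antidiagonal]
      apply md_inj d ℓ
      rw [Finsupp.mapDomain_add, ea, eb]; exact hp
    · rw [Prod.mk.injEq]; exact ⟨ea, eb⟩
  · intro p _; rfl

lemma resVar_X {d ℓ : ℕ} (i : Fin (d + 1)) :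
    resVar (X (varEmb d ℓ i) : MvPowerSeries (Fin (d + ℓ + 1)) R) = X i := by
  classical
  ext k
  show coeff (Finsupp.mapDomain (varEmb d ℓ) k) (X (varEmb d ℓ i) : MvPowerSeries _ R) = _
  rw [coeff_X, coeff_X, ← Finsupp.mapDomain_single]
  simp only [(md_inj d ℓ).eq_iff]

lemma resVar_fpd {d ℓ : ℕ} (i : Fin (d + 1)) (f : MvPowerSeries (Fin (d + ℓ + 1)) R) :
    resVar (fpderiv (varEmb d ℓ i) f) = fpderiv i (resVar f) := by
  ext k
  show ((Finsupp.mapDomain (varEmb d ℓ) k) (varEmb d ℓ i) + 1) •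
    f (Finsupp.mapDomain (varEmb d ℓ) k + Finsupp.single (varEmb d ℓ i) 1) =
    (k i + 1) • f (Finsupp.mapDomain (varEmb d ℓ) (k + Finsupp.single i 1))
  rw [Finsupp.mapDomain_apply (varEmb_inj d ℓ), Finsupp.mapDomain_add, Finsupp.mapDomain_single]

lemma resVar_sub {d ℓ : ℕ} (f g : MvPowerSeries (Fin (d + ℓ + 1)) R) :
    resVar (f - g) = resVar f - resVar g := rfl
lemma resVar_add {d ℓ : ℕ} (f g : MvPowerSeries (Fin (d + ℓ + 1)) R) :
    resVar (f + g) = resVar f + resVar g := rfl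

/-- An extension operator: a section of `resVar`. -/
def extVar {d ℓ : ℕ} (f : MvPowerSeries (Fin (d + 1)) R) : MvPowerSeries (Fin (d + ℓ + 1)) R :=
  Function.extend (Finsupp.mapDomain (varEmb d ℓ)) f 0

lemma resVar_extVar {d ℓ : ℕ} (f : MvPowerSeries (Fin (d + 1)) R) :
    resVar (extVar (ℓ := ℓ) f) = f := by
  ext k
  exact (md_inj d ℓ).extend_apply f 0 k

/-- index of the new variable -/
abbrev sIx (d : ℕ) : Fin (d + 1 + 1) := (Fin.last d).castSucc

lemma varEmb_last (d ℓ : ℕ) : varEmb d ℓ (Fin.last d) = Fin.last _ := by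
  simp [varEmb]

lemma varEmb_castSucc (d : ℕ) (i : Fin d) : varEmb d 1 i.castSucc = i.castSucc.castSucc := by
  simp [varEmb]; rfl

lemma sIx_notin (d : ℕ) : sIx d ∉ Set.range (varEmb d 1) := by
  rintro ⟨i, hi⟩
  unfold varEmb at hi
  split_ifs at hi with h <;> simp [Fin.ext_iff] at hi
  omega

lemma fpd_extVar {d : ℕ} (f : MvPowerSeries (Fin (d + 1)) R) :
    fpderiv (sIx d) (extVar (ℓ := 1) f) = 0 := by
  ext k
  show (k (sIx d) + 1) • Function.extend (Finsupp.mapDomain (varEmb d 1)) f 0 (k + Finsupp.single (sIx d) 1) = 0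
  have h0 : Function.extend (Finsupp.mapDomain (varEmb d 1)) (f : (Fin (d + 1) →₀ ℕ) → R) 0
      (k + Finsupp.single (sIx d) 1) = 0 := by
    refine (Function.extend_apply' _ _ _ ?_).trans rfl
    rintro ⟨a, ha⟩
    have := DFunLike.congr_fun ha (sIx d)
    rw [Finsupp.mapDomain_of_notMem_range a _ (sIx_notin d)] at this
    simp at this
  refine Eq.trans (congrArg _ h0) (smul_zero _)

lemma resVar_eq_zero {d : ℕ} (f : MvPowerSeries (Fin (d + 1 + 1)) R) (h : resVar (ℓ := 1) f = 0)
    (k : Fin (d + 1 + 1) →₀ ℕ) (hk : k (sIx d) = 0) : f k = 0 := by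
  have hs : (k.support : Set _) ⊆ Set.range (varEmb d 1) := by
    intro x hx
    have hx' := Finsupp.mem_support_iff.1 hx
    induction x using Fin.lastCases with
    | last => exact ⟨Fin.last d, varEmb_last d 1⟩
    | cast x =>
      induction x using Fin.lastCases with
      | last => exact absurd hk hx'
      | cast x => exact ⟨x.castSucc, varEmb_castSucc d x⟩
  have ea := Finsupp.mapDomain_comapDomain (varEmb d 1) (varEmb_inj d 1) k hs
  have := congrFun h (Finsupp.comapDomain (varEmb d 1) k (varEmb_inj d 1).injOn)
  rw [← ea]
  exact this

/-- formal antiderivative -/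
def intg [Algebra ℚ R] {m : ℕ} (s : Fin m) (f : MvPowerSeries (Fin m) R) : MvPowerSeries (Fin m) R :=
  fun k => if k s = 0 then 0 else ((k s : ℚ)⁻¹) • f (k - Finsupp.single s 1)

lemma fpd_intg [Algebra ℚ R] {m : ℕ} (s : Fin m) (f : MvPowerSeries (Fin m) R) :
    fpderiv s (intg s f) = f := by
  ext k
  show (k s + 1) • (if (k + Finsupp.single s 1 : Fin m →₀ ℕ) s = 0 then 0 else
    (((k + Finsupp.single s 1 : Fin m →₀ ℕ) s : ℚ)⁻¹) • f (k + Finsupp.single s 1 - Finsupp.single s 1)) = f k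
  rw [if_neg (by simp), add_tsub_cancel_right, ← Nat.cast_smul_eq_nsmul ℚ, smul_smul]
  have : ((k s + 1 : ℕ) : ℚ) * (((k + Finsupp.single s 1 : Fin m →₀ ℕ) s : ℚ)⁻¹) = 1 := by
    have h : (k + Finsupp.single s 1 : Fin m →₀ ℕ) s = k s + 1 := by simp
    rw [h]
    exact mul_inv_cancel₀ (by positivity)
  rw [this, one_smul]

lemma resVar_intg [Algebra ℚ R] {d : ℕ} (f : MvPowerSeries (Fin (d + 1 + 1)) R) :
    resVar (ℓ := 1) (intg (sIx d) f) = 0 := by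
  ext k
  show (if _ then _ else _) = (0 : R)
  rw [if_pos]
  exact Finsupp.mapDomain_of_notMem_range k _ (sIx_notin d)

/-- vanishing modulo `s^n` -/
def Zs {m : ℕ} (s : Fin m) (n : ℕ) (f : MvPowerSeries (Fin m) R) : Prop :=
  ∀ k, k s < n → f k = 0

lemma Zs_iff {m : ℕ} (s : Fin m) (n : ℕ) (f : MvPowerSeries (Fin m) R) :
    Zs s n f ↔ (X s : MvPowerSeries (Fin m) R) ^ n ∣ f := X_pow_dvd_iff.symm

lemma Zs_fpd {m : ℕ} {s i : Fin m} (h : i ≠ s) {n : ℕ} {f : MvPowerSeries (Fin m) R}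
    (hf : Zs s n f) : Zs s n (fpderiv i f) := by
  intro k hk
  show (k i + 1) • f (k + Finsupp.single i 1) = 0
  rw [hf _ (by simpa [Finsupp.single_apply, h] using hk), smul_zero]

lemma Zs_shf {m : ℕ} {s i : Fin m} (h : i ≠ s) {n : ℕ} {f : MvPowerSeries (Fin m) R}
    (hf : Zs s n f) : Zs s n (shf i f) := by
  intro k hk
  exact hf _ (by simpa [Finsupp.single_apply, h] using hk)

lemma Zs_ev0 {m : ℕ} {s i : Fin m} {n : ℕ} {f : MvPowerSeries (Fin m) R}
    (hf : Zs s n f) : Zs s n (ev0 i f) := by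
  intro k hk
  rw [ev0_apply, hf k hk, ite_self]

lemma Zs_of_X_mul {m : ℕ} {s i : Fin m} (h : i ≠ s) {n : ℕ} {f : MvPowerSeries (Fin m) R}
    (hf : Zs s n (X i * f)) : Zs s n f := by
  intro k hk
  refine (X_mul_apply i f k).symm.trans ?_
  exact hf _ (by simpa [Finsupp.single_apply, h] using hk)

lemma Zs_intg [Algebra ℚ R] {m : ℕ} {s : Fin m} {n : ℕ} {f : MvPowerSeries (Fin m) R}
    (hf : Zs s n f) : Zs s (n + 1) (intg s f) := by
  intro k hk
  show (if _ then _ else _) = (0 : R)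
  split_ifs with h
  · rfl
  · rw [hf _ (by simp; omega), smul_zero]

lemma intg_sub [Algebra ℚ R] {m : ℕ} (s : Fin m) (f g : MvPowerSeries (Fin m) R) :
    intg s f - intg s g = intg s (f - g) := by
  ext k
  show (if _ then _ else _) - (if _ then _ else _) = (if _ then _ else _ • (f _ - g _))
  split_ifs
  · simp
  · rw [smul_sub]

lemma Zs_step [Algebra ℚ R] {m : ℕ} {s : Fin m} {n : ℕ} {f : MvPowerSeries (Fin m) R}
    (h1 : ∀ k, k s = 0 → f k = 0) (hf : Zs s n (fpderiv s f)) : Zs s (n + 1) f := by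
  intro k hk
  by_cases h : k s = 0
  · exact h1 k h
  obtain ⟨k', rfl⟩ : ∃ k', k = k' + Finsupp.single s 1 := by
    refine ⟨k - Finsupp.single s 1, (tsub_add_cancel_of_le ?_).symm⟩
    rw [Finsupp.single_le_iff]; omega
  have h2 : (k' s + 1) • f (k' + Finsupp.single s 1) = 0 := hf k' (by simp at hk; omega)
  have h3 := congrArg (fun x => ((k' s + 1 : ℕ) : ℚ)⁻¹ • x) h2
  simp only [smul_zero] at h3
  rw [← Nat.cast_smul_eq_nsmul ℚ, smul_smul, inv_mul_cancel₀ (by positivity), one_smul] at h3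
  exact h3


variable {N : ℕ}

/-- entrywise derivative -/
def dm {m : ℕ} (i : Fin m) (M : Matrix (Fin N) (Fin N) (MvPowerSeries (Fin m) R)) :
    Matrix (Fin N) (Fin N) (MvPowerSeries (Fin m) R) := M.map (fpderiv i)

lemma dm_add {m : ℕ} (i : Fin m) (M L : Matrix (Fin N) (Fin N) (MvPowerSeries (Fin m) R)) :
    dm i (M + L) = dm i M + dm i L := by
  ext1 a b; simp [dm, fpd_eq]

lemma dm_sub {m : ℕ} (i : Fin m) (M L : Matrix (Fin N) (Fin N) (MvPowerSeries (Fin m) R)) :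
    dm i (M - L) = dm i M - dm i L := by
  ext1 a b; simp [dm, fpd_eq]

lemma dm_neg {m : ℕ} (i : Fin m) (M : Matrix (Fin N) (Fin N) (MvPowerSeries (Fin m) R)) :
    dm i (-M) = -dm i M := by
  ext1 a b; simp [dm, fpd_eq]

lemma dm_mul {m : ℕ} (i : Fin m) (M L : Matrix (Fin N) (Fin N) (MvPowerSeries (Fin m) R)) :
    dm i (M * L) = dm i M * L + M * dm i L := by
  ext1 a b
  simp only [dm, fpd_eq, Matrix.map_apply, Matrix.mul_apply, Matrix.add_apply, map_sum,
    Derivation.leibniz, smul_eq_mul, Finset.sum_add_distrib]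
  rw [add_comm]
  congr 1
  exact Finset.sum_congr rfl fun _ _ => mul_comm _ _

lemma dm_comm {m : ℕ} (i j : Fin m) (M : Matrix (Fin N) (Fin N) (MvPowerSeries (Fin m) R)) :
    dm i (dm j M) = dm j (dm i M) := by
  ext1 a b; exact fpd_comm i j _

lemma dm_smul {m : ℕ} {i u : Fin m} (h : i ≠ u)
    (M : Matrix (Fin N) (Fin N) (MvPowerSeries (Fin m) R)) :
    dm i ((X u : MvPowerSeries (Fin m) R) • M) = (X u : MvPowerSeries (Fin m) R) • dm i M := by
  ext1 a b
  simp [dm, fpd_eq, Derivation.leibniz, MvPowerSeries.pderiv_X_of_ne h.symm]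

lemma dm_smul_self {m : ℕ} (u : Fin m)
    (M : Matrix (Fin N) (Fin N) (MvPowerSeries (Fin m) R)) :
    dm u ((X u : MvPowerSeries (Fin m) R) • M) = (X u : MvPowerSeries (Fin m) R) • dm u M + M := by
  ext1 a b
  simp [dm, fpd_eq, Derivation.leibniz]

/-- entrywise vanishing modulo `s^n` -/
def ZM {m : ℕ} (s : Fin m) (n : ℕ) (M : Matrix (Fin N) (Fin N) (MvPowerSeries (Fin m) R)) : Prop :=
  ∀ a b, Zs s n (M a b)

section ZM
variable {m : ℕ} {s : Fin m} {n : ℕ} {M L : Matrix (Fin N) (Fin N) (MvPowerSeries (Fin m) R)}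

lemma ZM_zero : ZM s n (0 : Matrix (Fin N) (Fin N) (MvPowerSeries (Fin m) R)) :=
  fun _ _ _ _ => rfl
lemma ZM_add (h1 : ZM s n M) (h2 : ZM s n L) : ZM s n (M + L) := fun a b => by
  rw [Matrix.add_apply, Zs_iff]; exact dvd_add ((Zs_iff _ _ _).1 (h1 a b)) ((Zs_iff _ _ _).1 (h2 a b))
lemma ZM_sub (h1 : ZM s n M) (h2 : ZM s n L) : ZM s n (M - L) := fun a b => by
  rw [Matrix.sub_apply, Zs_iff]; exact dvd_sub ((Zs_iff _ _ _).1 (h1 a b)) ((Zs_iff _ _ _).1 (h2 a b))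
lemma ZM_neg (h1 : ZM s n M) : ZM s n (-M) := fun a b => by
  rw [Matrix.neg_apply, Zs_iff]; exact (dvd_neg).2 ((Zs_iff _ _ _).1 (h1 a b))
lemma ZM_mulL (h1 : ZM s n M) : ZM s n (L * M) := fun a b => by
  rw [Matrix.mul_apply, Zs_iff]
  exact Finset.dvd_sum fun c _ => ((Zs_iff _ _ _).1 (h1 c b)).mul_left _
lemma ZM_mulR (h1 : ZM s n M) : ZM s n (M * L) := fun a b => by
  rw [Matrix.mul_apply, Zs_iff]
  exact Finset.dvd_sum fun c _ => ((Zs_iff _ _ _).1 (h1 a c)).mul_right _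
lemma ZM_smul (f : MvPowerSeries (Fin m) R) (h1 : ZM s n M) : ZM s n (f • M) := fun a b => by
  rw [Matrix.smul_apply, Zs_iff, smul_eq_mul]
  exact ((Zs_iff _ _ _).1 (h1 a b)).mul_left _
lemma ZM_comm (h1 : ZM s n M) : ZM s n (L * M - M * L) := ZM_sub (ZM_mulL h1) (ZM_mulR h1)
lemma ZM_comm' (h1 : ZM s n M) : ZM s n (M * L - L * M) := ZM_sub (ZM_mulR h1) (ZM_mulL h1)
lemma ZM_dm {i : Fin m} (h : i ≠ s) (h1 : ZM s n M) : ZM s n (dm i M) :=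
  fun a b => Zs_fpd h (h1 a b)
lemma ZM_shf {i : Fin m} (h : i ≠ s) (h1 : ZM s n M) : ZM s n (M.map (shf i)) :=
  fun a b => Zs_shf h (h1 a b)
lemma ZM_ev0 {i : Fin m} (h1 : ZM s n M) : ZM s n ((ev0 i).mapMatrix M) :=
  fun a b => Zs_ev0 (h1 a b)
lemma ZM_of_smul {i : Fin m} (h : i ≠ s)
    (h1 : ZM s n ((X i : MvPowerSeries (Fin m) R) • M)) : ZM s n M :=
  fun a b => Zs_of_X_mul h (h1 a b)

lemma ZM_all (h : ∀ n, ZM s n M) : M = 0 := by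
  ext1 a b
  ext k
  exact h (k s + 1) a b k (Nat.lt_succ_self _)

end ZM

/-- abstract derivation property -/
structure IsDer {M : Type*} [Ring M] (D : M → M) : Prop where
  add : ∀ x y, D (x + y) = D x + D y
  sub : ∀ x y, D (x - y) = D x - D y
  neg : ∀ x, D (-x) = - D x
  mul : ∀ x y, D (x * y) = D x * y + x * D y

lemma bianchi_tt0 {S M : Type*} [CommRing S] [Ring M] [Algebra S M] {x : S} {s i j : M → M}
    (ds : IsDer s) (di : IsDer i) (dj : IsDer j)
    (hs : ∀ y, s (x • y) = x • s y) (hi : ∀ y, i (x • y) = x • i y)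
    (hj : ∀ y, j (x • y) = x • j y)
    (si : ∀ y, s (i y) = i (s y)) (sj : ∀ y, s (j y) = j (s y)) (ij : ∀ y, j (i y) = i (j y))
    {Ai Aj C Fi Fj : M}
    (h1 : x • s Ai = x • i C - (C * Ai - Ai * C) + Fi)
    (h2 : x • s Aj = x • j C - (C * Aj - Aj * C) + Fj)
    {E : M}
    (hE : E = x • (i Aj - j Ai) + (Ai * Aj - Aj * Ai)) :
    x • s E = -(C * E - E * C) + x • (i Fj - j Fi)
      + ((Fi * Aj - Aj * Fi) + (Ai * Fj - Fj * Ai)) := by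
  have d1 := congrArg j h1
  have d2 := congrArg i h2
  have e1 := congrArg (· * Aj) h1
  have e2 := congrArg (Aj * ·) h1
  have e3 := congrArg (Ai * ·) h2
  have e4 := congrArg (· * Ai) h2
  subst hE
  simp only [ds.add, ds.sub, ds.mul, di.add, di.sub, di.mul, dj.add, dj.sub, dj.mul,
    hs, hi, hj, si, sj, ij, mul_add, add_mul,
    mul_sub, sub_mul, smul_mul_assoc, mul_smul_comm, mul_assoc] at d1 d2 e1 e2 e3 e4 ⊢
  linear_combination (norm := module) x • d2 - x • d1 + e1 - e2 + e3 - e4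

lemma bianchi_tu0 {S M : Type*} [CommRing S] [Ring M] [Algebra S M] {x : S} {s i u : M → M}
    (ds : IsDer s) (di : IsDer i) (du : IsDer u)
    (hs : ∀ y, s (x • y) = x • s y) (hi : ∀ y, i (x • y) = x • i y)
    (hu : ∀ y, u (x • y) = x • u y + y)
    (si : ∀ y, s (i y) = i (s y)) (su : ∀ y, s (u y) = u (s y)) 
    {Ai B C Fi G : M}
    (h1 : x • s Ai = x • i C - (C * Ai - Ai * C) + Fi)
    (h2 : x • s B = -(x • C) + (B * C - C * B) + G)
    (hC : u C = 0) (hCi : u (i C) = 0) (hF : u Fi = 0)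
    {E : M}
    (hE : E = (x ^ 2) • u Ai + (B * Ai - Ai * B) - x • (Ai + i B)) :
    x • s E = -(C * E - E * C) - (2 : S) • x • Fi - x • i G
      + ((G * Ai - Ai * G) + (B * Fi - Fi * B)) := by
  have d1 := congrArg u h1
  have d2 := congrArg i h2
  have e1 := congrArg (· * Ai) h2
  have e2 := congrArg (Ai * ·) h2
  have e3 := congrArg (B * ·) h1
  have e4 := congrArg (· * B) h1
  subst hE
  simp only [ds.add, ds.sub, ds.mul, di.add, di.sub, di.mul, di.neg, du.add, du.sub,
    du.mul, hs, hi, hu, si, su, mul_add, add_mul,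
    mul_sub, sub_mul, smul_mul_assoc, mul_smul_comm, mul_assoc, hC, hF, hCi, pow_two,
    mul_smul, mul_zero, zero_mul, smul_zero, mul_neg, neg_mul] at d1 d2 e1 e2 e3 e4 ⊢
  linear_combination (norm := module) (x ^ 2) • d1 - x • d2 + e1 - e2 + e3 - e4 - (2 : S) • x • h1

lemma dm_isDer {m : ℕ} (i : Fin m) :
    IsDer (dm i : Matrix (Fin N) (Fin N) (MvPowerSeries (Fin m) R) → _) :=
  ⟨dm_add i, dm_sub i, dm_neg i, dm_mul i⟩

lemma fixpt {m : ℕ} {J : Type*} (s : Fin m)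
    (Φ : (J → Matrix (Fin N) (Fin N) (MvPowerSeries (Fin m) R)) →
      (J → Matrix (Fin N) (Fin N) (MvPowerSeries (Fin m) R)))
    (hΦ : ∀ n y y', (∀ j, ZM s n (y j - y' j)) → ∀ j, ZM s (n + 1) (Φ y j - Φ y' j)) :
    ∃ y, Φ y = y := by
  let Y : ℕ → (J → Matrix (Fin N) (Fin N) (MvPowerSeries (Fin m) R)) := fun n => Φ^[n] 0
  have hY : ∀ n, Y (n + 1) = Φ (Y n) := fun n => Function.iterate_succ_apply' Φ n 0
  have h1 : ∀ n j, ZM s n (Y (n + 1) j - Y n j) := by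
    intro n
    induction n with
    | zero => intro j a b k hk; exact absurd hk (Nat.not_lt_zero _)
    | succ n ih =>
      intro j
      rw [hY (n + 1), hY n]
      refine hΦ n _ _ ?_ j
      intro j
      have := ih j
      rw [hY n] at this
      exact this
  have h2 : ∀ p n, ∀ j a b k, k s < n → (Y (n + p) j a b) k = (Y n j a b) k := by
    intro p
    induction p with
    | zero => intros; rfl
    | succ p ih =>
      intro n j a b k hk
      rw [← ih n j a b k hk]
      have := h1 (n + p) j a b k (by omega)
      exact sub_eq_zero.1 this
  let y : J → Matrix (Fin N) (Fin N) (MvPowerSeries (Fin m) R) :=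
    fun j a b k => Y (k s + 1) j a b k
  have h3 : ∀ n j, ZM s n (y j - Y n j) := by
    intro n j a b k hk
    have := h2 (n - (k s + 1)) (k s + 1) j a b k (Nat.lt_succ_self _)
    rw [show k s + 1 + (n - (k s + 1)) = n by omega] at this
    exact sub_eq_zero.2 this.symm
  refine ⟨y, ?_⟩
  funext j
  refine sub_eq_zero.1 (ZM_all (s := s) fun n => ?_)
  have e1 := hΦ n _ _ (h3 n) j
  have e2 := h3 (n + 1) j
  rw [hY] at e2
  have e3 := ZM_sub e1 e2
  rw [sub_sub_sub_cancel_right] at e3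
  exact fun a b k hk => e3 a b k (by omega)

section lft
variable {m : ℕ} {J : Type*} {s : Fin m} {n : ℕ}
  {g g' : J → Matrix (Fin N) (Fin N) (MvPowerSeries (Fin m) R)}

lemma lift_cong (h : ∀ j, ZM s n (g j - g' j)) (p : FreeAlgebra R J) :
    ZM s n (FreeAlgebra.lift R g p - FreeAlgebra.lift R g' p) := by
  induction p using FreeAlgebra.induction with
  | grade0 r => simp only [AlgHom.commutes, sub_self]; exact ZM_zero
  | grade1 j => simpa using h j
  | mul a b ha hb =>
    rw [map_mul, map_mul]
    have := ZM_add (ZM_mulR (L := FreeAlgebra.lift R g b) ha)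
      (ZM_mulL (L := FreeAlgebra.lift R g' a) hb)
    convert this using 1
    noncomm_ring
  | add a b ha hb =>
    rw [map_add, map_add, add_sub_add_comm]
    exact ZM_add ha hb

lemma lift_comm (h : ∀ i j, ZM s n (g i * g j - g j * g i)) (p : FreeAlgebra R J) (j : J) :
    ZM s n (FreeAlgebra.lift R g p * g j - g j * FreeAlgebra.lift R g p) := by
  induction p using FreeAlgebra.induction with
  | grade0 r =>
    rw [AlgHom.commutes, Algebra.commutes, sub_self]; exact ZM_zero
  | grade1 i => simpa using h i j
  | mul a b ha hb =>
    rw [map_mul]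
    have := ZM_add (ZM_mulR (L := FreeAlgebra.lift R g b) ha)
      (ZM_mulL (L := FreeAlgebra.lift R g a) hb)
    convert this using 1
    noncomm_ring
  | add a b ha hb =>
    rw [map_add]
    have := ZM_add ha hb
    convert this using 1
    noncomm_ring
end lft

/-- restriction of matrices -/
def rM {d : ℕ} (M : Matrix (Fin N) (Fin N) (MvPowerSeries (Fin (d + 1 + 1)) R)) :
    Matrix (Fin N) (Fin N) (MvPowerSeries (Fin (d + 1)) R) := M.map (resVar (ℓ := 1))

section rM
variable {d : ℕ} (M L : Matrix (Fin N) (Fin N) (MvPowerSeries (Fin (d + 1 + 1)) R))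
lemma rM_add : rM (M + L) = rM M + rM L := rfl
lemma rM_sub : rM (M - L) = rM M - rM L := rfl
lemma rM_mul : rM (M * L) = rM M * rM L := by
  ext1 a b
  simp only [rM, Matrix.map_apply, Matrix.mul_apply]
  rw [← Finset.sum_congr rfl fun c _ => resVar_mul (M a c) (L c b)]
  exact map_sum (AddMonoidHom.mk' (resVar (R := R) (d := d) (ℓ := 1)) resVar_add)
    (fun c => M a c * L c b) Finset.univ
lemma rM_smul : rM ((X (Fin.last (d + 1)) : MvPowerSeries (Fin (d + 1 + 1)) R) • M) =
    (X (Fin.last d) : MvPowerSeries (Fin (d + 1)) R) • rM M := by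
  ext1 a b
  show resVar (ℓ := 1) (X (Fin.last (d + 1)) * M a b) = X (Fin.last d) * resVar (M a b)
  rw [resVar_mul, ← resVar_X (ℓ := 1) (Fin.last d), varEmb_last]
lemma rM_dm_last : rM (dm (Fin.last (d + 1)) M) = (rM M).map (fpderiv (Fin.last d)) := by
  ext1 a b
  show resVar (ℓ := 1) (fpderiv (Fin.last (d + 1)) (M a b)) = _
  have := resVar_fpd (ℓ := 1) (Fin.last d) (M a b)
  rw [varEmb_last] at this
  exact this
lemma rM_dm (i : Fin d) :
    rM (dm i.castSucc.castSucc M) = (rM M).map (fpderiv i.castSucc) := by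
  ext1 a b
  show resVar (ℓ := 1) (fpderiv i.castSucc.castSucc (M a b)) = _
  have := resVar_fpd (ℓ := 1) i.castSucc (M a b)
  rw [varEmb_castSucc] at this
  exact this

lemma ZM_step [Algebra ℚ R] {n : ℕ} (h0 : rM M = 0) (h : ZM (sIx d) n (dm (sIx d) M)) :
    ZM (sIx d) (n + 1) M := fun a b =>
  Zs_step (fun k hk => resVar_eq_zero (M a b) (congrFun (congrFun h0 a) b) k hk) (h a b)
end rM

section onestep
variable {d : ℕ}

/-- The matrix in the new direction. -/
def Cof (p : FreeAlgebra R (Option (Fin d)))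
    (y : Option (Fin d) → Matrix (Fin N) (Fin N) (MvPowerSeries (Fin (d + 1 + 1)) R)) :
    Matrix (Fin N) (Fin N) (MvPowerSeries (Fin (d + 1 + 1)) R) :=
  FreeAlgebra.lift R (fun j => (ev0 (Fin.last (d + 1))).mapMatrix (y j)) p

lemma Cof_eq (p : FreeAlgebra R (Option (Fin d)))
    (y : Option (Fin d) → Matrix (Fin N) (Fin N) (MvPowerSeries (Fin (d + 1 + 1)) R)) :
    Cof p y = (ev0 (Fin.last (d + 1))).mapMatrix (FreeAlgebra.lift R y p) := by
  have : FreeAlgebra.lift R (fun j => (ev0 (Fin.last (d + 1))).mapMatrix (y j)) =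
      ((ev0 (Fin.last (d + 1))).mapMatrix).comp (FreeAlgebra.lift R y) := by
    ext j; simp
  unfold Cof
  rw [this]; rfl

/-- right-hand side of the evolution equation -/
def rhs (p : FreeAlgebra R (Option (Fin d)))
    (y : Option (Fin d) → Matrix (Fin N) (Fin N) (MvPowerSeries (Fin (d + 1 + 1)) R)) :
    Option (Fin d) → Matrix (Fin N) (Fin N) (MvPowerSeries (Fin (d + 1 + 1)) R)
  | none => -Cof p y + (y none * Cof p y - Cof p y * y none).map (shf (Fin.last (d + 1)))
  | some i => dm i.castSucc.castSucc (Cof p y) -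
      (Cof p y * y (some i) - y (some i) * Cof p y).map (shf (Fin.last (d + 1)))

lemma ne_su : sIx d ≠ Fin.last (d + 1) := by simp [Fin.ext_iff]
lemma ne_is (i : Fin d) : i.castSucc.castSucc ≠ sIx d := by
  have := i.2
  simp only [ne_eq, Fin.ext_iff, Fin.val_castSucc, Fin.val_last]; omega
lemma ne_iu (i : Fin d) : i.castSucc.castSucc ≠ Fin.last (d + 1) := by
  have := i.2
  simp only [ne_eq, Fin.ext_iff, Fin.val_castSucc, Fin.val_last]; omega

lemma comm_cong {m : ℕ} {s : Fin m} {n : ℕ}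
    {M L M' L' : Matrix (Fin N) (Fin N) (MvPowerSeries (Fin m) R)}
    (h1 : ZM s n (M - M')) (h2 : ZM s n (L - L')) :
    ZM s n ((M * L - L * M) - (M' * L' - L' * M')) := by
  have := ZM_add (ZM_comm' (L := L) h1) (ZM_comm (L := M') h2)
  convert this using 1
  noncomm_ring

lemma map_shf_sub {m : ℕ} (u : Fin m)
    (M L : Matrix (Fin N) (Fin N) (MvPowerSeries (Fin m) R)) :
    (M - L).map (shf u) = M.map (shf u) - L.map (shf u) := rfl

lemma rhs_cong (p : FreeAlgebra R (Option (Fin d))) {n : ℕ}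
    {y y' : Option (Fin d) → Matrix (Fin N) (Fin N) (MvPowerSeries (Fin (d + 1 + 1)) R)}
    (h : ∀ j, ZM (sIx d) n (y j - y' j)) (j : Option (Fin d)) :
    ZM (sIx d) n (rhs p y j - rhs p y' j) := by
  have hC : ZM (sIx d) n (Cof p y - Cof p y') := by
    apply lift_cong
    intro j
    rw [← map_sub]
    exact ZM_ev0 (h j)
  cases j with
  | none =>
    have h1 := ZM_shf (i := Fin.last (d + 1)) ne_su.symm (comm_cong (h none) hC)
    have := ZM_add (ZM_neg hC) h1
    convert this using 1
    rw [map_shf_sub]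
    simp only [rhs]
    abel
  | some i =>
    have h1 := ZM_shf (i := Fin.last (d + 1)) ne_su.symm (comm_cong hC (h (some i)))
    have := ZM_sub (ZM_dm (ne_is i) hC) h1
    convert this using 1
    rw [dm_sub, map_shf_sub]
    simp only [rhs]
    abel

lemma smul_shf {m : ℕ} (u : Fin m) (M : Matrix (Fin N) (Fin N) (MvPowerSeries (Fin m) R)) :
    (X u : MvPowerSeries (Fin m) R) • M.map (shf u) = M - (ev0 u).mapMatrix M := by
  ext1 a b
  exact X_mul_shf u (M a b)

lemma dm_ev0 {m : ℕ} (u : Fin m) (M : Matrix (Fin N) (Fin N) (MvPowerSeries (Fin m) R)) :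
    dm u ((ev0 u).mapMatrix M) = 0 := by
  ext1 a b
  exact fpd_ev0 u (M a b)

lemma exists_sol [Algebra ℚ R] (p : FreeAlgebra R (Option (Fin d)))
    (y0 : Option (Fin d) → Matrix (Fin N) (Fin N) (MvPowerSeries (Fin (d + 1)) R)) :
    ∃ y : Option (Fin d) → Matrix (Fin N) (Fin N) (MvPowerSeries (Fin (d + 1 + 1)) R),
      (∀ j, rM (y j) = y0 j) ∧ ∀ j, dm (sIx d) (y j) = rhs p y j := by
  obtain ⟨y, hy⟩ := fixpt (sIx d)
    (fun y j => (y0 j).map (extVar (ℓ := 1)) + (rhs p y j).map (intg (sIx d))) (by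
      intro n y y' h j
      rw [add_sub_add_left_eq_sub]
      intro a b
      show Zs _ _ (intg (sIx d) (rhs p y j a b) - intg (sIx d) (rhs p y' j a b))
      rw [intg_sub]
      exact Zs_intg (rhs_cong p h j a b))
  refine ⟨y, fun j => ?_, fun j => ?_⟩
  · have := congrFun hy j
    rw [← this, rM_add]
    ext1 a b
    show resVar (extVar (y0 j a b)) + resVar (intg (sIx d) (rhs p y j a b)) = _
    rw [resVar_extVar, resVar_intg, add_zero]
  · have := congrArg (dm (sIx d)) (congrFun hy j)
    rw [← this, dm_add]
    ext1 a b
    show fpderiv _ (extVar (y0 j a b)) + fpderiv _ (intg (sIx d) (rhs p y j a b)) = _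
    rw [fpd_extVar, fpd_intg, zero_add]
end onestep

section onestep2
variable {d : ℕ}

lemma ev0_X_smul {m : ℕ} (u : Fin m) (M : Matrix (Fin N) (Fin N) (MvPowerSeries (Fin m) R)) :
    (ev0 u).mapMatrix ((X u : MvPowerSeries (Fin m) R) • M) = 0 := by
  ext1 a b
  show ev0 u (X u * M a b) = 0
  have h : ev0 u (X u : MvPowerSeries (Fin m) R) = 0 := by
    classical
    ext k
    show (if k u = 0 then coeff k (X u : MvPowerSeries (Fin m) R) else 0) = 0
    rw [coeff_X]
    split_ifs with h1 h2
    · rw [h2] at h1; simp at h1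
    · rfl
    · rfl
  rw [map_mul, h, zero_mul]

lemma ev0_ev0 {m : ℕ} (u : Fin m) (M : Matrix (Fin N) (Fin N) (MvPowerSeries (Fin m) R)) :
    (ev0 u).mapMatrix ((ev0 u).mapMatrix M) = (ev0 u).mapMatrix M := by
  ext1 a b
  ext k
  show (if k u = 0 then (if k u = 0 then M a b k else 0) else 0) = (if k u = 0 then M a b k else 0)
  split_ifs <;> rfl

set_option maxHeartbeats 2000000 in
theorem onestep [Algebra ℚ R] (F : FBundle R d N) (p : FreeAlgebra R (Option (Fin d))) :
    ∃ (F' : FBundle R (d + 1) N)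
      (y : Option (Fin d) → Matrix (Fin N) (Fin N) (MvPowerSeries (Fin (d + 1 + 1)) R)),
      (∀ j : Fin d, F'.A j.castSucc = y (some j)) ∧ F'.B = y none ∧
      F'.A (Fin.last d) = Cof p y ∧
      (∀ j : Fin d, rM (y (some j)) = F.A j) ∧ rM (y none) = F.B := by
  obtain ⟨y, hy0, hy⟩ := exists_sol p (fun j => j.elim F.B F.A)
  have hy0n : rM (y none) = F.B := hy0 none
  have hy0s : ∀ i, rM (y (some i)) = F.A i := fun i => hy0 (some i)
  set C := Cof p y with hCdef
  set u : Fin (d + 1 + 1) := Fin.last (d + 1) with hu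
  let Fi : Fin d → Matrix (Fin N) (Fin N) (MvPowerSeries (Fin (d + 1 + 1)) R) :=
    fun i => (ev0 u).mapMatrix (C * y (some i) - y (some i) * C)
  let G : Matrix (Fin N) (Fin N) (MvPowerSeries (Fin (d + 1 + 1)) R) :=
    -(ev0 u).mapMatrix (y none * C - C * y none)
  have h1 : ∀ i : Fin d, (X u : MvPowerSeries (Fin (d + 1 + 1)) R) • dm (sIx d) (y (some i))
      = (X u : MvPowerSeries (Fin (d + 1 + 1)) R) • dm i.castSucc.castSucc C
        - (C * y (some i) - y (some i) * C) + Fi i := by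
    intro i
    rw [hy (some i)]
    simp only [rhs]
    rw [smul_sub, smul_shf, sub_sub_eq_add_sub]
    simp only [Fi]
    rw [← hCdef]
    abel
  have h2 : (X u : MvPowerSeries (Fin (d + 1 + 1)) R) • dm (sIx d) (y none)
      = -((X u : MvPowerSeries (Fin (d + 1 + 1)) R) • C) + (y none * C - C * y none) + G := by
    rw [hy none]
    simp only [rhs]
    rw [smul_add, smul_shf, smul_neg]
    simp only [G]
    rw [← hCdef]
    abel
  have hCu : (ev0 u).mapMatrix C = C := by
    rw [hCdef, Cof_eq, ev0_ev0]
  have hC : dm u C = 0 := by rw [← hCu, dm_ev0]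
  have dm0 : ∀ i : Fin (d + 1 + 1),
      dm i (0 : Matrix (Fin N) (Fin N) (MvPowerSeries (Fin (d + 1 + 1)) R)) = 0 := by
    intro i; rw [← sub_self (0 : Matrix (Fin N) (Fin N) (MvPowerSeries (Fin (d + 1 + 1)) R)), dm_sub]
    simp
  have hCi : ∀ i : Fin d, dm u (dm i.castSucc.castSucc C) = 0 := by
    intro i
    rw [dm_comm, hC, dm0]
  have hF : ∀ i, dm u (Fi i) = 0 := fun i => dm_ev0 _ _
  let E : Fin d → Fin d → Matrix (Fin N) (Fin N) (MvPowerSeries (Fin (d + 1 + 1)) R) :=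
    fun i j => (X u : MvPowerSeries (Fin (d + 1 + 1)) R) •
      (dm i.castSucc.castSucc (y (some j)) - dm j.castSucc.castSucc (y (some i)))
      + (y (some i) * y (some j) - y (some j) * y (some i))
  let H : Fin d → Matrix (Fin N) (Fin N) (MvPowerSeries (Fin (d + 1 + 1)) R) :=
    fun i => (X u ^ 2 : MvPowerSeries (Fin (d + 1 + 1)) R) • dm u (y (some i))
      + (y none * y (some i) - y (some i) * y none)
      - (X u : MvPowerSeries (Fin (d + 1 + 1)) R) • (y (some i) + dm i.castSucc.castSucc (y none))
  have E0 : ∀ i j, rM (E i j) = 0 := by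
    intro i j
    simp only [E]
    rw [rM_add, rM_smul, rM_sub, rM_sub, rM_mul, rM_mul, rM_dm, rM_dm, hy0s, hy0s]
    exact F.flat_tt i j
  have H0 : ∀ i, rM (H i) = 0 := by
    intro i
    simp only [H]
    rw [rM_sub, rM_add, pow_two, mul_smul, rM_smul, rM_smul, rM_smul, rM_sub, rM_add, rM_mul,
      rM_mul, rM_dm, rM_dm_last, hy0s, hy0n, sub_eq_zero]
    have := F.flat_tu i
    rw [pow_two, mul_smul] at this
    exact this
  -- commutation of the residues modulo `s^n`
  have hcomm : ∀ n, (∀ i j, ZM (sIx d) n (E i j)) → (∀ i, ZM (sIx d) n (H i)) →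
      (∀ i, ZM (sIx d) n (Fi i)) ∧ ZM (sIx d) n G := by
    intro n hE hH
    have hss : ∀ i j : Fin d, ZM (sIx d) n ((ev0 u).mapMatrix (y (some i)) *
        (ev0 u).mapMatrix (y (some j)) - (ev0 u).mapMatrix (y (some j)) *
        (ev0 u).mapMatrix (y (some i))) := by
      intro i j
      have := ZM_ev0 (i := u) (hE i j)
      simp only [E] at this
      rw [map_add, ev0_X_smul, zero_add, map_sub, map_mul, map_mul] at this
      exact this
    have hns : ∀ i : Fin d, ZM (sIx d) n ((ev0 u).mapMatrix (y none) *
        (ev0 u).mapMatrix (y (some i)) - (ev0 u).mapMatrix (y (some i)) *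
        (ev0 u).mapMatrix (y none)) := by
      intro i
      have := ZM_ev0 (i := u) (hH i)
      simp only [H] at this
      rw [map_sub, map_add, ev0_X_smul, pow_two, mul_smul, ev0_X_smul, zero_add, sub_zero,
        map_sub, map_mul, map_mul] at this
      exact this
    have key : ∀ j, ZM (sIx d) n (C * (ev0 u).mapMatrix (y j) - (ev0 u).mapMatrix (y j) * C) := by
      intro j
      refine lift_comm (g := fun j => (ev0 u).mapMatrix (y j)) ?_ p j
      intro i j
      rcases i with _ | i <;> rcases j with _ | j
      · rw [sub_self]; exact ZM_zero
      · exact hns j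
      · rw [← neg_sub]; exact ZM_neg (hns i)
      · exact hss i j
    constructor
    · intro i
      simp only [Fi]
      rw [map_sub, map_mul, map_mul, hCu]
      exact key (some i)
    · simp only [G]
      rw [map_sub, map_mul, map_mul, hCu, neg_sub]
      exact key none
  have main : ∀ n, (∀ i j, ZM (sIx d) n (E i j)) ∧ (∀ i, ZM (sIx d) n (H i)) := by
    intro n
    induction n with
    | zero =>
      exact ⟨fun i j a b k hk => absurd hk (Nat.not_lt_zero _),
        fun i a b k hk => absurd hk (Nat.not_lt_zero _)⟩
    | succ n ih =>
      obtain ⟨zF, zG⟩ := hcomm n ih.1 ih.2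
      constructor
      · intro i j
        apply ZM_step _ (E0 i j)
        apply ZM_of_smul (i := u) ne_su.symm
        rw [bianchi_tt0 (dm_isDer _) (dm_isDer _) (dm_isDer _) (dm_smul ne_su) (dm_smul (ne_iu i))
          (dm_smul (ne_iu j)) (dm_comm _ _) (dm_comm _ _) (dm_comm _ _) (h1 i) (h1 j)
          (E := E i j) rfl]
        exact ZM_add (ZM_add (ZM_neg (ZM_comm (ih.1 i j)))
          (ZM_smul _ (ZM_sub (ZM_dm (ne_is i) (zF j)) (ZM_dm (ne_is j) (zF i)))))
          (ZM_add (ZM_comm' (zF i)) (ZM_comm (zF j)))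
      · intro i
        apply ZM_step _ (H0 i)
        apply ZM_of_smul (i := u) ne_su.symm
        rw [bianchi_tu0 (dm_isDer _) (dm_isDer _) (dm_isDer _) (dm_smul ne_su) (dm_smul (ne_iu i))
          (dm_smul_self u) (dm_comm _ _) (dm_comm _ _) (h1 i) h2 hC (hCi i) (hF i)
          (E := H i) rfl]
        exact ZM_add (ZM_sub (ZM_sub (ZM_neg (ZM_comm (ih.2 i)))
          (ZM_smul _ (ZM_smul _ (zF i)))) (ZM_smul _ (ZM_dm (ne_is i) zG)))
          (ZM_add (ZM_comm' zG) (ZM_comm (zF i)))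
  have Ez : ∀ i j, E i j = 0 := fun i j => ZM_all fun n => (main n).1 i j
  have Hz : ∀ i, H i = 0 := fun i => ZM_all fun n => (main n).2 i
  have Fz : ∀ i, Fi i = 0 := fun i =>
    ZM_all fun n => (hcomm n (main n).1 (main n).2).1 i
  have Gz : G = 0 := ZM_all fun n => (hcomm n (main n).1 (main n).2).2
  let A' : Fin (d + 1) → Matrix (Fin N) (Fin N) (MvPowerSeries (Fin (d + 1 + 1)) R) :=
    Fin.lastCases C (fun j => y (some j))
  have hAl : A' (Fin.last d) = C := Fin.lastCases_last
  have hAs : ∀ j : Fin d, A' j.castSucc = y (some j) := fun j => Fin.lastCases_castSucc j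
  have t1 : ∀ i : Fin d, (X u : MvPowerSeries (Fin (d + 1 + 1)) R) •
      (dm (sIx d) (y (some i)) - dm i.castSucc.castSucc C)
      + (C * y (some i) - y (some i) * C) = 0 := by
    intro i
    rw [smul_sub, h1 i, Fz]
    abel
  refine ⟨⟨A', y none, ?_, ?_⟩, y, hAs, rfl, hAl, hy0s, hy0n⟩
  · intro i j
    change (X u : MvPowerSeries (Fin (d + 1 + 1)) R) •
      (dm i.castSucc (A' j) - dm j.castSucc (A' i)) + (A' i * A' j - A' j * A' i) = 0
    induction i using Fin.lastCases with
    | last =>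
      induction j using Fin.lastCases with
      | last => simp
      | cast j => rw [hAl, hAs]; exact t1 j
    | cast i =>
      induction j using Fin.lastCases with
      | last =>
        rw [hAl, hAs]
        have := t1 i
        rw [← neg_eq_zero, neg_add, ← smul_neg, neg_sub, neg_sub] at this
        exact this
      | cast j => rw [hAs, hAs]; exact Ez i j
  · intro i
    change (X u ^ 2 : MvPowerSeries (Fin (d + 1 + 1)) R) • dm u (A' i)
      + (y none * A' i - A' i * y none)
      = (X u : MvPowerSeries (Fin (d + 1 + 1)) R) • (A' i + dm i.castSucc (y none))
    induction i using Fin.lastCases with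
    | last =>
      rw [hAl, hC, smul_zero, zero_add, smul_add, h2, Gz]
      abel
    | cast i => rw [hAs]; exact sub_eq_zero.1 (Hz i)
end onestep2

section final
variable {d : ℕ}

/-- constant coefficient as an algebra map -/
def cc (m : ℕ) : MvPowerSeries (Fin m) R →ₐ[R] R :=
  { (constantCoeff : MvPowerSeries (Fin m) R →+* R) with
    commutes' := fun r => by
      show constantCoeff (algebraMap R (MvPowerSeries (Fin m) R) r) = _
      rw [MvPowerSeries.algebraMap_apply, constantCoeff_C] }

lemma onestep' [Algebra ℚ R] (F : FBundle R d N) (Mx : Matrix (Fin N) (Fin N) R)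
    (hM : Mx ∈ Algebra.adjoin R (Set.range (resid F) ∪ {residB F})) :
    ∃ F' : FBundle R (d + 1) N, (∀ j : Fin d, (F'.A j.castSucc).map (resVar (ℓ := 1)) = F.A j) ∧
      F'.B.map (resVar (ℓ := 1)) = F.B ∧ resid F' (Fin.last d) = Mx := by
  let g0 : Option (Fin d) → Matrix (Fin N) (Fin N) R := fun j => j.elim (residB F) (resid F)
  have hg : Set.range (resid F) ∪ {residB F} = Set.range g0 := by
    ext x
    simp only [Set.mem_union, Set.mem_range, Set.mem_singleton_iff, Option.exists, g0,
      Option.elim]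
    rw [or_comm, eq_comm]
  rw [hg, Algebra.adjoin_range_eq_range_freeAlgebra_lift] at hM
  obtain ⟨p, rfl⟩ := hM
  obtain ⟨F', y, hA, hB, hC, h0, h0n⟩ := onestep F p
  refine ⟨F', fun j => by rw [hA j]; exact h0 j, by rw [hB]; exact h0n, ?_⟩
  have e1 : resid F' (Fin.last d) = (cc (d + 1 + 1)).mapMatrix (Cof p y) := by
    rw [← hC]; rfl
  have e2 : ((cc (d + 1 + 1)).mapMatrix).comp
      (FreeAlgebra.lift R (fun j => (ev0 (Fin.last (d + 1))).mapMatrix (y j))) =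
      FreeAlgebra.lift R g0 := by
    apply FreeAlgebra.hom_ext
    funext j
    simp only [Function.comp_apply, AlgHom.comp_apply, FreeAlgebra.lift_ι_apply]
    have hz : ∀ f : MvPowerSeries (Fin (d + 1 + 1)) R,
        cc (d + 1 + 1) (ev0 (Fin.last (d + 1)) f) = resVar (ℓ := 1) (d := d) f 0 := by
      intro f
      show (if (0 : Fin (d + 1 + 1) →₀ ℕ) (Fin.last (d + 1)) = 0 then f 0 else 0) = f (Finsupp.mapDomain _ 0)
      rw [if_pos (Finsupp.zero_apply), Finsupp.mapDomain_zero]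
    cases j with
    | none =>
      ext a b
      refine (hz _).trans ?_
      show rM (y none) a b 0 = F.B a b 0
      rw [h0n]
    | some j =>
      ext a b
      refine (hz _).trans ?_
      show rM (y (some j)) a b 0 = F.A j a b 0
      rw [h0]
  rw [e1]
  exact DFunLike.congr_fun e2 p

lemma varEmb_comp (d ℓ : ℕ) : varEmb d (ℓ + 1) = varEmb (d + ℓ) 1 ∘ varEmb d ℓ := by
  funext i
  simp only [Function.comp_apply, varEmb]
  split_ifs with h1 h2 h2
  · rfl
  · simp only at h2; omega
  · simp at h2
  · rfl

lemma resVar_resVar {d ℓ : ℕ} (f : MvPowerSeries (Fin (d + ℓ + 1 + 1)) R) :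
    resVar (d := d) (ℓ := ℓ + 1) f = resVar (d := d) (ℓ := ℓ) (resVar (d := d + ℓ) (ℓ := 1) f) := by
  ext k
  show f (Finsupp.mapDomain _ k) = f (Finsupp.mapDomain _ (Finsupp.mapDomain _ k))
  rw [varEmb_comp, Finsupp.mapDomain_comp]

lemma varEmb_zero (d : ℕ) : varEmb d 0 = id := by
  funext i
  have := i.2
  simp only [varEmb]
  split_ifs with h
  · rfl
  · ext; simp; omega

lemma resVar_zero {d : ℕ} (f : MvPowerSeries (Fin (d + 1)) R) :
    resVar (d := d) (ℓ := 0) f = f := by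
  ext k
  show f (Finsupp.mapDomain _ k) = f k
  rw [varEmb_zero, Finsupp.mapDomain_id]

lemma manystep [Algebra ℚ R] (F : FBundle R d N) (v : Fin N → R)
    (hGC : ∀ x : Fin N → R, ∃ Mx ∈ Algebra.adjoin R
      (Set.range (resid F) ∪ {residB F}), Mx.mulVec v = x) (ℓ : ℕ) :
    ∀ w : Fin ℓ → (Fin N → R), ∃ F' : FBundle R (d + ℓ) N,
      (∀ j : Fin d, (F'.A (Fin.castAdd ℓ j)).map (resVar (ℓ := ℓ)) = F.A j) ∧
      F'.B.map (resVar (ℓ := ℓ)) = F.B ∧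
      ∀ k, (resid F' (Fin.natAdd d k)).mulVec v = w k := by
  induction ℓ with
  | zero =>
    intro w
    refine ⟨F, fun j => ?_, ?_, fun k => k.elim0⟩
    · ext1 a b; exact resVar_zero _
    · ext1 a b; exact resVar_zero _
  | succ ℓ ih =>
    intro w
    obtain ⟨F1, hA, hB, hw⟩ := ih (fun k => w k.castSucc)
    obtain ⟨Mx, hM, hMv⟩ := hGC (w (Fin.last ℓ))
    have hM1 : Mx ∈ Algebra.adjoin R (Set.range (resid F1) ∪ {residB F1}) := by
      refine Algebra.adjoin_mono ?_ hM
      apply Set.union_subset_union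
      · rintro _ ⟨j, rfl⟩
        refine ⟨Fin.castAdd ℓ j, ?_⟩
        ext a b
        show F1.A _ a b 0 = F.A j a b 0
        rw [← hA j]
        show _ = F1.A _ a b (Finsupp.mapDomain _ 0)
        rw [Finsupp.mapDomain_zero]
      · rw [Set.singleton_subset_iff, Set.mem_singleton_iff]
        ext a b
        show F.B a b 0 = F1.B a b 0
        rw [← hB]
        show F1.B a b (Finsupp.mapDomain _ 0) = _
        rw [Finsupp.mapDomain_zero]
    obtain ⟨F2, kA, kB, kM⟩ := onestep' F1 Mx hM1
    refine ⟨F2, fun j => ?_, ?_, fun k => ?_⟩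
    · rw [← hA j, ← kA]
      ext1 a b
      exact resVar_resVar _
    · rw [← hB, ← kB]
      ext1 a b
      exact resVar_resVar _
    · induction k using Fin.lastCases with
      | last => rw [← hMv, ← kM]; rfl
      | cast k =>
        have h2 := hw k
        rw [← h2]
        have : resid F2 (Fin.natAdd d k.castSucc) = resid F1 (Fin.natAdd d k) := by
          ext a b
          show F2.A _ a b 0 = F1.A _ a b 0
          rw [← kA]
          show _ = F2.A _ a b (Finsupp.mapDomain _ 0)
          rw [Finsupp.mapDomain_zero]
          rfl
        rw [this]

end final
end helpers

theorem stmt8 {R : Type*} [CommRing R] [IsDomain R] [Algebra ℚ R] {d N : ℕ}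
    (F : FBundle R d N) (v : Fin N → R)
    -- (IC): the evaluation map `μ_v` is injective
    (hIC : Function.Injective (evalMat F v).mulVecLin)
    -- (GC): the orbit of `v` under `R[im μ, K]` is the whole fiber
    (hGC : ∀ x : Fin N → R, ∃ Mx ∈ Algebra.adjoin R
      (Set.range (resid F) ∪ {residB F}), Mx.mulVec v = x)
    -- `coker μ_v` is free
    (hfree : Module.Free R ((Fin N → R) ⧸ LinearMap.range (evalMat F v).mulVecLin)) :
    ∃ F' : FBundle R (d + (N - d)) N,
      ∃ P : Matrix (Fin N) (Fin N) (MvPowerSeries (Fin (d + 1)) R),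
        UnfoldsVia F F' P ∧
        -- the cyclic vector of the unfolding is induced from `v`
        (P.map fun f => f (0 : Fin (d + 1) →₀ ℕ)) = 1 ∧
        -- maximality: the evaluation map of `F'` at `v` is bijective
        Function.Bijective (evalMat F' v).mulVecLin := by
  set f := (evalMat F v).mulVecLin with hf
  have hr : Module.finrank R (LinearMap.range f) = d := by
    rw [LinearMap.finrank_range_of_inj hIC]; simp
  have hq := Submodule.finrank_quotient_add_finrank (LinearMap.range f)
  have hq' : Module.finrank R ((Fin N → R) ⧸ LinearMap.range f) = N - d := by
    rw [hr, Module.finrank_fin_fun] at hq; omega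
  let b : Module.Basis (Fin (N - d)) R ((Fin N → R) ⧸ LinearMap.range f) :=
    Module.finBasisOfFinrankEq R _ hq'
  have hsurj : ∀ k, ∃ w, (LinearMap.range f).mkQ w = b k := fun k =>
    Submodule.mkQ_surjective _ _
  choose w hw using hsurj
  obtain ⟨F', hA, hB, hF'⟩ := manystep F v hGC (N - d) w
  have d1 : ∀ i : Fin (d + 1), (1 : Matrix (Fin N) (Fin N) (MvPowerSeries (Fin (d + 1)) R)).map
      (fpderiv i) = 0 := by
    intro i
    have := dm_mul i (1 : Matrix (Fin N) (Fin N) (MvPowerSeries (Fin (d + 1)) R)) 1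
    rw [mul_one, mul_one, one_mul] at this
    exact left_eq_add.1 this
  refine ⟨F', 1, ⟨isUnit_one, fun j => ?_, ?_⟩, ?_, ?_⟩
  · rw [d1, smul_zero, zero_add, mul_one, one_mul]; exact hA j
  · rw [d1, smul_zero, zero_add, mul_one, one_mul]; exact hB
  · exact map_one ((cc (R := R) (d + 1)).mapMatrix (m := Fin N))
  · have key : ∀ x : Fin (d + (N - d)) → R, (evalMat F' v).mulVecLin x =
        f (fun j => x (Fin.castAdd _ j)) + ∑ k, x (Fin.natAdd d k) • w k := by
      intro x
      funext a
      simp only [Matrix.mulVecLin_apply, Matrix.mulVec, dotProduct, Fin.sum_univ_add,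
        Pi.add_apply, Finset.sum_apply, Pi.smul_apply, smul_eq_mul, hf]
      congr 1
      · refine Finset.sum_congr rfl fun j _ => ?_
        have : resid F' (Fin.castAdd (N - d) j) = resid F j := by
          ext a b
          show F'.A _ a b 0 = F.A j a b 0
          rw [← hA j]
          show _ = F'.A _ a b (Finsupp.mapDomain _ 0)
          rw [Finsupp.mapDomain_zero]
        simp only [evalMat, Matrix.of_apply, this]
      · refine Finset.sum_congr rfl fun k _ => ?_
        simp only [evalMat, Matrix.of_apply]
        rw [hF' k, mul_comm]
    have keyq : ∀ x : Fin (d + (N - d)) → R, (LinearMap.range f).mkQ ((evalMat F' v).mulVecLin x) =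
        ∑ k, x (Fin.natAdd d k) • b k := by
      intro x
      rw [key, map_add, map_sum]
      simp only [map_smul, hw]
      have : (LinearMap.range f).mkQ (f (fun j => x (Fin.castAdd _ j))) = 0 := by
        rw [Submodule.mkQ_apply, Submodule.Quotient.mk_eq_zero]
        exact ⟨_, rfl⟩
      rw [this, zero_add]
    constructor
    · rw [← LinearMap.ker_eq_bot, LinearMap.ker_eq_bot']
      intro x hx
      have h1 := keyq x
      rw [hx, map_zero] at h1
      have h2 := Fintype.linearIndependent_iff.1 b.linearIndependent _ h1.symm
      have h3 := key x
      rw [hx] at h3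
      simp only [h2, zero_smul, Finset.sum_const_zero, add_zero] at h3
      have h4 : (fun j => x (Fin.castAdd (N - d) j)) = 0 := hIC (by rw [← h3, map_zero])
      funext i
      induction i using Fin.addCases with
      | left j => exact congrFun h4 j
      | right k => exact h2 k
    · intro z
      let c := b.repr ((LinearMap.range f).mkQ z)
      have hc : ∑ k, c k • b k = (LinearMap.range f).mkQ z := b.sum_repr _
      have h1 : z - ∑ k, c k • w k ∈ LinearMap.range f := by
        rw [← Submodule.Quotient.mk_eq_zero, ← Submodule.mkQ_apply, map_sub, map_sum, ← hc]
        simp only [map_smul, hw, sub_self]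
      obtain ⟨a, ha⟩ := h1
      refine ⟨Fin.addCases a c, ?_⟩
      rw [key]
      simp only [Fin.addCases_left, Fin.addCases_right]
      rw [ha, sub_add_cancel]
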